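/- arXiv:1901.05192 — 2 statements merged into one kernel-verified Lean document; each statement's English description precedes it below -/
import Mathlib

section
/- Let a > 0. There exists a constant C > 0, depending only on a, such that for every integer n ≥ 3, every f ∈ C^n([0,a], ℂ), every choice of distinct nodes 0 = x̂_0 < x̂_1 < … < x̂_{n-1} = a including both endpoints, and every real w > 0: |∫_0^a (f(x) − f̂(x)) · log(x) · e^{iwx} dx| ≤ C · (1 + |log w|) · w^{-2} · ‖f^{(n)}‖_∞ · a^{n-1} / (n-2)!, where f̂ is the Lagrange interpolant of f of degree ≤ n-1 at the nodes. -/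
open Set MeasureTheory Polynomial

/-- **Rolle's theorem**, counting zeros: a function with `k + 1` zeros in an interval has a
derivative with at least `k` zeros there. -/
theorem exists_finset_zeros_of_hasDerivWithinAt {a b : ℝ} {u u' : ℝ → ℝ}
    (hu : ∀ x ∈ Icc a b, HasDerivWithinAt u (u' x) (Icc a b) x) {k : ℕ} {S : Finset ℝ}
    (hS : S.card = k + 1) (hz : ∀ x ∈ S, x ∈ Icc a b ∧ u x = 0) :
    ∃ T : Finset ℝ, T.card = k ∧ ∀ x ∈ T, x ∈ Icc a b ∧ u' x = 0 := by
  classical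
  set e := S.orderEmbOfFin hS with he
  have hm : ∀ i, e i ∈ Icc a b ∧ u (e i) = 0 := fun i => hz _ (S.orderEmbOfFin_mem hS i)
  have hlt : ∀ i : Fin k, e i.castSucc < e i.succ := fun i =>
    e.strictMono (Fin.castSucc_lt_succ)
  have key : ∀ i : Fin k, ∃ c ∈ Ioo (e i.castSucc) (e i.succ), u' c = 0 := by
    intro i
    have hsub : Icc (e i.castSucc) (e i.succ) ⊆ Icc a b :=
      Icc_subset_Icc (hm _).1.1 (hm _).1.2
    refine exists_hasDerivAt_eq_zero (hlt i)
      (fun x hx => ((hu x (hsub hx)).continuousWithinAt).mono hsub)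
      ((hm _).2.trans (hm _).2.symm) fun x hx => ?_
    exact (hu x (hsub (Ioo_subset_Icc_self hx))).hasDerivAt
      (Icc_mem_nhds ((hm _).1.1.trans_lt hx.1) (hx.2.trans_le (hm _).1.2))
  choose c hc hc0 using key
  have hmono : StrictMono c := by
    intro i j hij
    have h1 : e i.succ ≤ e j.castSucc := e.monotone (by
      rw [Fin.le_def]; simpa using hij)
    exact (hc i).2.trans_le (h1.trans (hc j).1.le)
  refine ⟨Finset.univ.image c, ?_, ?_⟩
  · rw [Finset.card_image_of_injective _ hmono.injective]; simp
  · intro x hx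
    obtain ⟨i, -, rfl⟩ := Finset.mem_image.1 hx
    exact ⟨⟨(hm _).1.1.trans (hc i).1.le, (hc i).2.le.trans (hm _).1.2⟩, hc0 i⟩

/-- Iterated Rolle: if `u 0, …, u m` are successive derivatives and `u 0` has `k + j` zeros with
`j ≤ m`, then `u j` has `k` zeros. -/
theorem exists_finset_zeros_of_iterated_hasDerivWithinAt {a b : ℝ} {m : ℕ} {u : ℕ → ℝ → ℝ}
    (hu : ∀ k < m, ∀ x ∈ Icc a b, HasDerivWithinAt (u k) (u (k + 1) x) (Icc a b) x)
    {S : Finset ℝ} (hz : ∀ x ∈ S, x ∈ Icc a b ∧ u 0 x = 0) {j : ℕ} :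
    ∀ {k : ℕ}, j ≤ m → S.card = k + j →
    ∃ T : Finset ℝ, T.card = k ∧ ∀ x ∈ T, x ∈ Icc a b ∧ u j x = 0 := by
  induction j with
  | zero => exact fun _ hS => ⟨S, hS, hz⟩
  | succ j ih =>
    intro k hj hS
    obtain ⟨T, hT, hT0⟩ := ih (k := k + 1) (by omega) (by omega)
    exact exists_finset_zeros_of_hasDerivWithinAt (hu j (by omega)) hT hT0

/-- Interpolation error bound: a function with `m` zeros in `[a, b]` is bounded by
`(b - a) ^ m / m!` times a bound of its `m`-th derivative. -/
theorem abs_le_of_card_zeros {a b M : ℝ} {m : ℕ} {u : ℕ → ℝ → ℝ}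
    (hu : ∀ k < m, ∀ x ∈ Icc a b, HasDerivWithinAt (u k) (u (k + 1) x) (Icc a b) x)
    (hM : ∀ x ∈ Icc a b, |u m x| ≤ M)
    {S : Finset ℝ} (hS : S.card = m) (hz : ∀ x ∈ S, x ∈ Icc a b ∧ u 0 x = 0)
    {x : ℝ} (hx : x ∈ Icc a b) : |u 0 x| ≤ M * (b - a) ^ m / m.factorial := by
  classical
  have hM0 : 0 ≤ M := (abs_nonneg _).trans (hM x hx)
  have hba : 0 ≤ b - a := sub_nonneg.2 (hx.1.trans hx.2)
  by_cases hxS : x ∈ S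
  · rw [(hz x hxS).2, abs_zero]; positivity
  set W : ℝ[X] := ∏ s ∈ S, (X - C s) with hW
  set v : ℕ → ℝ → ℝ := fun k t => u k t * W.eval x - u 0 x * (derivative^[k] W).eval t with hv
  have hv' : ∀ k < m, ∀ t ∈ Icc a b, HasDerivWithinAt (v k) (v (k + 1) t) (Icc a b) t := by
    intro k hk t ht
    have h2 := ((derivative^[k] W).hasDerivAt t).hasDerivWithinAt (s := Icc a b)
    rw [← Function.iterate_succ_apply' derivative] at h2
    exact ((hu k hk t ht).mul_const _).sub (h2.const_mul _)
  have hvz : ∀ t ∈ insert x S, t ∈ Icc a b ∧ v 0 t = 0 := by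
    intro t ht
    rcases Finset.mem_insert.1 ht with rfl | ht
    · exact ⟨hx, by simp [hv]⟩
    · refine ⟨(hz t ht).1, ?_⟩
      have : W.eval t = 0 := by
        rw [hW, eval_prod]; exact Finset.prod_eq_zero ht (by simp)
      simp [hv, this, (hz t ht).2]
  obtain ⟨T, hT, hT0⟩ := exists_finset_zeros_of_iterated_hasDerivWithinAt hv' hvz (j := m) (k := 1)
    le_rfl (by rw [Finset.card_insert_of_notMem hxS, hS, add_comm])
  obtain ⟨ξ, rfl⟩ := Finset.card_eq_one.1 hT
  obtain ⟨hξ, hξ0⟩ := hT0 ξ (by simp)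
  have hWm : (derivative^[m] W).eval ξ = m.factorial := by
    rw [hW, iterate_derivative_prod_X_sub_C hS.ge, hS]; simp
  have heq : u m ξ * W.eval x = u 0 x * m.factorial := by
    have : u m ξ * W.eval x - u 0 x * (derivative^[m] W).eval ξ = 0 := hξ0
    rw [hWm] at this; linarith
  have hWx : |W.eval x| ≤ (b - a) ^ m := by
    rw [hW, eval_prod, Finset.abs_prod, ← hS, ← Finset.prod_const]
    refine Finset.prod_le_prod (fun _ _ => abs_nonneg _) fun s hs => ?_
    have := (hz s hs).1
    simp only [eval_sub, eval_X, eval_C]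
    exact abs_le.2 ⟨by linarith [this.2, hx.1], by linarith [this.1, hx.2]⟩
  rw [le_div_iff₀ (by positivity), ← abs_of_nonneg (Nat.cast_nonneg (α := ℝ) m.factorial),
    ← abs_mul, ← heq, abs_mul]
  exact mul_le_mul (hM ξ hξ) hWx (abs_nonneg _) hM0

/-- Complex-valued interpolation error bound for derivatives: if `D 0` has `n` zeros in `[a, b]`,
its `j`-th derivative is bounded by `(b - a) ^ (n - j) / (n - j)!` times a bound of the `n`-th. -/
theorem norm_le_of_card_zeros {a b M : ℝ} {n : ℕ} {D : ℕ → ℝ → ℂ}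
    (hD : ∀ k < n, ∀ x ∈ Icc a b, HasDerivWithinAt (D k) (D (k + 1) x) (Icc a b) x)
    (hM : ∀ x ∈ Icc a b, ‖D n x‖ ≤ M)
    {S : Finset ℝ} (hS : S.card = n) (hz : ∀ x ∈ S, x ∈ Icc a b ∧ D 0 x = 0)
    {j : ℕ} (hj : j ≤ n) {x : ℝ} (hx : x ∈ Icc a b) :
    ‖D j x‖ ≤ M * (b - a) ^ (n - j) / (n - j).factorial := by
  have hM0 : 0 ≤ M := (norm_nonneg _).trans (hM x hx)
  have hba : 0 ≤ b - a := sub_nonneg.2 (hx.1.trans hx.2)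
  by_cases h0 : D j x = 0
  · rw [h0, norm_zero]; positivity
  set c : ℂ := (starRingEnd ℂ) (D j x) / ‖D j x‖ with hc
  have hn0 : (‖D j x‖ : ℂ) ≠ 0 := by exact_mod_cast norm_ne_zero_iff.2 h0
  have hc1 : ‖c‖ = 1 := by
    rw [hc, norm_div, RCLike.norm_conj, Complex.norm_real, norm_norm,
      div_self (norm_ne_zero_iff.2 h0)]
  have hcD : c * D j x = ‖D j x‖ := by
    rw [hc, div_mul_eq_mul_div, mul_comm, Complex.mul_conj, Complex.normSq_eq_norm_sq]
    push_cast
    field_simp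
  set u : ℕ → ℝ → ℝ := fun k t => (c * D k t).re with hu
  have hu' : ∀ k < n, ∀ t ∈ Icc a b, HasDerivWithinAt (u k) (u (k + 1) t) (Icc a b) t :=
    fun k hk t ht => Complex.reCLM.hasFDerivAt.comp_hasDerivWithinAt t ((hD k hk t ht).const_mul c)
  obtain ⟨T, hT, hT0⟩ := exists_finset_zeros_of_iterated_hasDerivWithinAt hu' (S := S)
    (fun t ht => ⟨(hz t ht).1, by simp [hu, (hz t ht).2]⟩) (j := j) (k := n - j) hj (by omega)
  have := abs_le_of_card_zeros (M := M) (m := n - j) (u := fun k => u (j + k))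
    (fun k hk t ht => hu' (j + k) (by omega) t ht)
    (fun t ht => by
      have e : j + (n - j) = n := by omega
      simp only [e]
      refine (Complex.abs_re_le_norm _).trans ?_
      rw [norm_mul, hc1, one_mul]
      exact hM t ht) hT hT0 hx
  simp only [hu, add_zero, hcD, Complex.ofReal_re, abs_norm] at this
  exact this

/-- Splitting off the logarithm of the right endpoint. -/
theorem abs_log_le_abs_log_add_div {x b : ℝ} (hx : 0 < x) (hxb : x ≤ b) :
    |Real.log x| ≤ |Real.log b| + b / x := by
  have hb : 0 < b := hx.trans_le hxb
  have h1 : Real.log x = Real.log b - Real.log (b / x) := by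
    rw [Real.log_div hb.ne' hx.ne']; ring
  have h2 : 0 ≤ Real.log (b / x) := Real.log_nonneg ((one_le_div hx).2 hxb)
  have h3 : Real.log (b / x) ≤ b / x := (Real.log_le_sub_one_of_pos (by positivity)).trans (by simp)
  rw [h1]
  exact (abs_sub _ _).trans (by rw [abs_of_nonneg h2]; linarith)

theorem norm_cexp_I_mul_ofReal_mul_ofReal (w x : ℝ) : ‖Complex.exp (Complex.I * w * x)‖ = 1 := by
  rw [show Complex.I * w * x = ((w * x : ℝ) : ℂ) * Complex.I by push_cast; ring]
  exact Complex.norm_exp_ofReal_mul_I _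

/-- The trivial bound of the logarithmic oscillatory integral near the origin. -/
theorem norm_integral_mul_log_mul_cexp_le {δ K : ℝ} (hδ : 0 < δ) {g : ℝ → ℂ}
    (hK : 0 ≤ K) (hg : ∀ x ∈ Ioc 0 δ, ‖g x‖ ≤ K * x) (w : ℝ) :
    ‖∫ x in (0)..δ, g x * (Real.log x : ℂ) * Complex.exp (Complex.I * w * x)‖
      ≤ K * (|Real.log δ| + 1) * δ ^ 2 := by
  have := intervalIntegral.norm_integral_le_of_norm_le_const (a := 0) (b := δ)
    (f := fun x : ℝ => g x * (Real.log x : ℂ) * Complex.exp (Complex.I * w * x))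
    (C := K * (δ * (|Real.log δ| + 1))) (fun x hx => by
      rw [uIoc_of_le hδ.le] at hx
      rw [norm_mul, norm_mul, norm_cexp_I_mul_ofReal_mul_ofReal, mul_one, Complex.norm_real,
        Real.norm_eq_abs]
      calc ‖g x‖ * |Real.log x| ≤ (K * x) * (|Real.log δ| + δ / x) := by
            gcongr
            · exact mul_nonneg hK hx.1.le
            · exact hg x hx
            · exact abs_log_le_abs_log_add_div hx.1 hx.2
        _ = K * (x * |Real.log δ| + δ) := by have := hx.1.ne'; field_simp
        _ ≤ K * (δ * |Real.log δ| + δ) := by gcongr; exact hx.2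
        _ = K * (δ * (|Real.log δ| + 1)) := by ring)
  rw [sub_zero, abs_of_pos hδ] at this
  calc _ ≤ _ := this
    _ = _ := by ring

/-- Integrating twice by parts against `exp (I w x)`. -/
theorem integral_mul_cexp_eq_of_hasDerivAt {δ a w : ℝ} (hδa : δ ≤ a) (hw : w ≠ 0)
    {h h' h'' : ℝ → ℂ} (hc : ContinuousOn h (Icc δ a)) (hc' : ContinuousOn h' (Icc δ a))
    (hc'' : ContinuousOn h'' (Icc δ a)) (hd : ∀ x ∈ Ioo δ a, HasDerivAt h (h' x) x)
    (hd' : ∀ x ∈ Ioo δ a, HasDerivAt h' (h'' x) x) :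
    ∫ x in δ..a, h x * Complex.exp (Complex.I * w * x) =
      (-Complex.I * h a / w + h' a / w ^ 2) * Complex.exp (Complex.I * w * a)
      - (-Complex.I * h δ / w + h' δ / w ^ 2) * Complex.exp (Complex.I * w * δ)
      - (∫ x in δ..a, h'' x * Complex.exp (Complex.I * w * x)) / w ^ 2 := by
  have hwc : (w : ℂ) ≠ 0 := by exact_mod_cast hw
  have he : Continuous fun x : ℝ => Complex.exp (Complex.I * w * x) := by fun_prop
  have hi : IntervalIntegrable (fun x => h x * Complex.exp (Complex.I * w * x)) volume δ a :=
    (hc.mul he.continuousOn).intervalIntegrable_of_Icc hδa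
  have hi'' : IntervalIntegrable (fun x => h'' x * Complex.exp (Complex.I * w * x) / w ^ 2)
      volume δ a :=
    ((hc''.mul he.continuousOn).div_const _).intervalIntegrable_of_Icc hδa
  have hF := intervalIntegral.integral_eq_sub_of_hasDerivAt_of_le hδa
    (f := fun x => (-Complex.I * h x / w + h' x / w ^ 2) * Complex.exp (Complex.I * w * x))
    (f' := fun x => h x * Complex.exp (Complex.I * w * x)
      + h'' x * Complex.exp (Complex.I * w * x) / w ^ 2)
    (by fun_prop) (fun x hx => by
      have h1 : HasDerivAt (fun x : ℝ => Complex.exp (Complex.I * w * x))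
          (Complex.exp (Complex.I * w * x) * (Complex.I * w * 1)) x :=
        (((Complex.ofRealCLM.hasDerivAt (x := x)).const_mul (Complex.I * w))).cexp
      have h2 := ((((hd x hx).const_mul (-Complex.I)).div_const (w : ℂ)).add
        ((hd' x hx).div_const ((w : ℂ) ^ 2))).mul h1
      refine h2.congr_deriv ?_
      simp only [Pi.add_apply]
      field_simp
      ring_nf
      simp only [Complex.I_sq]
      ring)
    (hi.add hi'')
  rw [intervalIntegral.integral_add hi hi'', intervalIntegral.integral_div] at hF
  rw [← hF]; ring

/-- The oscillatory integral away from the origin. -/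
theorem norm_integral_mul_log_mul_cexp_le_of_inv_lt {a K w : ℝ} (hK : 0 ≤ K) (hw : 0 < w)
    (hwa : w⁻¹ ≤ a) {g g' g'' : ℝ → ℂ}
    (hd : ∀ x ∈ Icc 0 a, HasDerivWithinAt g (g' x) (Icc 0 a) x)
    (hd' : ∀ x ∈ Icc 0 a, HasDerivWithinAt g' (g'' x) (Icc 0 a) x)
    (hc'' : ContinuousOn g'' (Icc 0 a))
    (hg : ∀ x ∈ Icc 0 a, ‖g x‖ ≤ K * x) (hg' : ∀ x ∈ Icc 0 a, ‖g' x‖ ≤ K)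
    (hg'' : ∀ x ∈ Icc 0 a, ‖g'' x‖ ≤ K / a) (hga : g a = 0) :
    ‖∫ x in w⁻¹..a, g x * (Real.log x : ℂ) * Complex.exp (Complex.I * w * x)‖
      ≤ K * (6 * |Real.log w| + 6 * |Real.log a| + 1) * (w ^ 2)⁻¹ := by
  have hδ : 0 < w⁻¹ := inv_pos.2 hw
  have ha : 0 < a := hδ.trans_le hwa
  have hsub : Icc w⁻¹ a ⊆ Icc 0 a := Icc_subset_Icc_left hδ.le
  have hpos : ∀ x ∈ Icc w⁻¹ a, 0 < x := fun x hx => hδ.trans_le hx.1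
  have hne : ∀ x ∈ Icc w⁻¹ a, x ≠ 0 := fun x hx => (hpos x hx).ne'
  have hnec : ∀ x ∈ Icc w⁻¹ a, (x : ℂ) ≠ 0 := fun x hx => by exact_mod_cast hne x hx
  have hcg : ContinuousOn g (Icc w⁻¹ a) := fun x hx => (hd x (hsub hx)).continuousWithinAt.mono hsub
  have hcg' : ContinuousOn g' (Icc w⁻¹ a) :=
    fun x hx => (hd' x (hsub hx)).continuousWithinAt.mono hsub
  have hcg'' := hc''.mono hsub
  have hcl : ContinuousOn (fun x : ℝ => (Real.log x : ℂ)) (Icc w⁻¹ a) :=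
    Complex.continuous_ofReal.comp_continuousOn
      (Real.continuousOn_log.mono fun x hx => by simpa using hne x hx)
  have hcx : ContinuousOn (fun x : ℝ => (x : ℂ)) (Icc w⁻¹ a) := Complex.continuous_ofReal.continuousOn
  have hnhds : ∀ x ∈ Ioo w⁻¹ a, Icc 0 a ∈ nhds x := fun x hx => Icc_mem_nhds (hδ.trans hx.1) hx.2
  have hlogd : ∀ x ∈ Ioo w⁻¹ a, HasDerivAt (fun x : ℝ => (Real.log x : ℂ)) ((x : ℂ)⁻¹) x := by
    intro x hx
    have := (Real.hasDerivAt_log (hne x (Ioo_subset_Icc_self hx))).ofReal_comp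
    simpa using this
  set h' : ℝ → ℂ := fun x => g' x * (Real.log x : ℂ) + g x / x with hh'
  set h'' : ℝ → ℂ := fun x => g'' x * (Real.log x : ℂ) + 2 * g' x / x - g x / x ^ 2 with hh''
  have hibp := integral_mul_cexp_eq_of_hasDerivAt hwa hw.ne'
    (h := fun x => g x * (Real.log x : ℂ)) (h' := h') (h'' := h'')
    (hcg.mul hcl) ((hcg'.mul hcl).add (hcg.div hcx hnec))
    (((hcg''.mul hcl).add ((continuousOn_const.mul hcg').div hcx hnec)).sub
      (hcg.div (hcx.pow 2) fun x hx => pow_ne_zero 2 (hnec x hx)))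
    (fun x hx => by
      have hx' := Ioo_subset_Icc_self hx
      exact ((hd x (hsub hx')).hasDerivAt (hnhds x hx)).mul (hlogd x hx))
    (fun x hx => by
      have hx' := Ioo_subset_Icc_self hx
      have h1 := (hd x (hsub hx')).hasDerivAt (hnhds x hx)
      have h2 := (hd' x (hsub hx')).hasDerivAt (hnhds x hx)
      have h3 : HasDerivAt (fun x : ℝ => (x : ℂ)) 1 x := Complex.ofRealCLM.hasDerivAt
      refine ((h2.mul (hlogd x hx)).add (h1.div h3 (hnec x hx'))).congr_deriv ?_
      have := hnec x hx'
      simp only [hh'']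
      field_simp
      ring)
  have hinva : (1 : ℝ) ≤ w * a := by
    have := mul_le_mul_of_nonneg_left hwa hw.le
    rwa [mul_inv_cancel₀ hw.ne'] at this
  have hbound : ∀ x ∈ Icc w⁻¹ a, ‖h'' x‖ ≤ K / a * |Real.log a| + 4 * K * x⁻¹ := by
    intro x hx
    have hx0 := hpos x hx
    have hn : ‖(x : ℂ)‖ = x := by rw [Complex.norm_real, Real.norm_of_nonneg hx0.le]
    calc ‖h'' x‖ ≤ ‖g'' x‖ * |Real.log x| + 2 * ‖g' x‖ / x + ‖g x‖ / x ^ 2 := by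
          refine (norm_sub_le _ _).trans (add_le_add ((norm_add_le _ _).trans (le_of_eq ?_))
            (le_of_eq ?_))
          · rw [norm_mul, norm_div, norm_mul, hn, Complex.norm_real, Real.norm_eq_abs]; simp
          · rw [norm_div, norm_pow, hn]
      _ ≤ K / a * (|Real.log a| + a / x) + 2 * K / x + K * x / x ^ 2 := by
          gcongr
          · exact hg'' x (hsub hx)
          · exact abs_log_le_abs_log_add_div hx0 hx.2
          · exact hg' x (hsub hx)
          · exact hg x (hsub hx)
      _ = K / a * |Real.log a| + 4 * K * x⁻¹ := by field_simp; ring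
  have hlogsum : Real.log (a / w⁻¹) ≤ |Real.log a| + |Real.log w| := by
    rw [Real.log_div ha.ne' hδ.ne', Real.log_inv, sub_neg_eq_add]
    exact add_le_add (le_abs_self _) (le_abs_self _)
  have hint : ‖∫ x in w⁻¹..a, h'' x * Complex.exp (Complex.I * w * x)‖
      ≤ 5 * K * |Real.log a| + 4 * K * |Real.log w| := by
    have hii : IntervalIntegrable (fun x : ℝ => 4 * K * x⁻¹) volume w⁻¹ a := by
      refine ContinuousOn.intervalIntegrable_of_Icc hwa ?_
      exact continuousOn_const.mul (continuousOn_id.inv₀ hne)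
    calc _ ≤ ∫ x in w⁻¹..a, (K / a * |Real.log a| + 4 * K * x⁻¹) := by
          refine intervalIntegral.norm_integral_le_of_norm_le hwa ?_
            (intervalIntegrable_const.add hii)
          refine Filter.Eventually.of_forall fun x hx => ?_
          rw [norm_mul, norm_cexp_I_mul_ofReal_mul_ofReal, mul_one]
          exact hbound x (Ioc_subset_Icc_self hx)
      _ = (a - w⁻¹) * (K / a * |Real.log a|) + 4 * K * Real.log (a / w⁻¹) := by
          rw [intervalIntegral.integral_add intervalIntegrable_const hii,
            intervalIntegral.integral_const, intervalIntegral.integral_const_mul,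
            integral_inv_of_pos hδ ha, smul_eq_mul]
      _ ≤ a * (K / a * |Real.log a|) + 4 * K * (|Real.log a| + |Real.log w|) := by
          gcongr
          linarith
      _ = _ := by field_simp; ring
  have hla : ‖(-Complex.I * (g a * (Real.log a : ℂ)) / w + h' a / w ^ 2)
      * Complex.exp (Complex.I * w * a)‖ ≤ K * |Real.log a| * (w ^ 2)⁻¹ := by
    rw [norm_mul, norm_cexp_I_mul_ofReal_mul_ofReal, mul_one]
    simp only [hh', hga, zero_mul, mul_zero, zero_div, zero_add, add_zero]
    rw [norm_div, norm_mul, norm_pow, Complex.norm_real, Complex.norm_real, Real.norm_eq_abs,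
      Real.norm_of_nonneg hw.le, div_eq_mul_inv]
    gcongr
    exact hg' a ⟨ha.le, le_rfl⟩
  have hlδ : ‖(-Complex.I * (g w⁻¹ * (Real.log w⁻¹ : ℂ)) / w + h' w⁻¹ / w ^ 2)
      * Complex.exp (Complex.I * w * (w⁻¹ : ℝ))‖ ≤ K * (2 * |Real.log w| + 1) * (w ^ 2)⁻¹ := by
    have hm : w⁻¹ ∈ Icc 0 a := ⟨hδ.le, hwa⟩
    have h1 : ‖h' w⁻¹‖ ≤ K * |Real.log w| + K := by
      refine (norm_add_le _ _).trans ?_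
      rw [norm_mul, norm_div, Complex.norm_real, Complex.norm_real, Real.norm_eq_abs,
        Real.norm_of_nonneg hδ.le, Real.log_inv, abs_neg]
      gcongr
      · exact hg' _ hm
      · rw [div_le_iff₀ hδ]; exact hg _ hm
    rw [norm_mul, norm_cexp_I_mul_ofReal_mul_ofReal, mul_one]
    refine (norm_add_le _ _).trans ?_
    rw [norm_div, norm_div, norm_mul, norm_mul, norm_pow, Complex.norm_real, Complex.norm_real,
      Real.norm_of_nonneg hw.le, norm_neg, Complex.norm_I, one_mul, Real.norm_eq_abs, Real.log_inv,
      abs_neg]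
    calc _ ≤ K * w⁻¹ * |Real.log w| / w + (K * |Real.log w| + K) / w ^ 2 := by
          gcongr
          exact hg _ hm
      _ = _ := by field_simp; ring
  have hlast : ‖(∫ x in w⁻¹..a, h'' x * Complex.exp (Complex.I * w * x)) / (w : ℂ) ^ 2‖
      ≤ (5 * K * |Real.log a| + 4 * K * |Real.log w|) * (w ^ 2)⁻¹ := by
    rw [norm_div, norm_pow, Complex.norm_real, Real.norm_of_nonneg hw.le, div_eq_mul_inv]
    gcongr
  rw [hibp]
  refine (norm_sub_le _ _).trans ((add_le_add ((norm_sub_le _ _).trans (add_le_add hla hlδ))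
    hlast).trans (le_of_eq ?_))
  ring

/-- A function vanishing linearly at `0` and vanishing at `a`, with two bounded derivatives, has
logarithmic Fourier integral of order `(1 + |log w|) / w ^ 2`. -/
theorem norm_integral_Ioc_mul_log_mul_cexp_le {a K w : ℝ} (ha : 0 < a) (hK : 0 ≤ K) (hw : 0 < w)
    {g g' g'' : ℝ → ℂ}
    (hd : ∀ x ∈ Icc 0 a, HasDerivWithinAt g (g' x) (Icc 0 a) x)
    (hd' : ∀ x ∈ Icc 0 a, HasDerivWithinAt g' (g'' x) (Icc 0 a) x)
    (hc'' : ContinuousOn g'' (Icc 0 a))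
    (hg : ∀ x ∈ Icc 0 a, ‖g x‖ ≤ K * x) (hg' : ∀ x ∈ Icc 0 a, ‖g' x‖ ≤ K)
    (hg'' : ∀ x ∈ Icc 0 a, ‖g'' x‖ ≤ K / a) (hga : g a = 0) :
    ‖∫ x in Ioc 0 a, g x * (Real.log x : ℂ) * Complex.exp (Complex.I * w * x)‖
      ≤ 7 * (1 + |Real.log a|) * (1 + |Real.log w|) * (w ^ 2)⁻¹ * K := by
  have hla := abs_nonneg (Real.log a)
  have hlw := abs_nonneg (Real.log w)
  rw [← intervalIntegral.integral_of_le ha.le]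
  rcases le_total a w⁻¹ with haw | haw
  · refine (norm_integral_mul_log_mul_cexp_le ha hK
      (fun x hx => hg x (Ioc_subset_Icc_self hx)) w).trans ?_
    have h1 : a ^ 2 ≤ (w ^ 2)⁻¹ := by rw [← inv_pow]; gcongr
    calc K * (|Real.log a| + 1) * a ^ 2
        ≤ K * (7 * (1 + |Real.log a|) * (1 + |Real.log w|)) * (w ^ 2)⁻¹ := by
          gcongr
          nlinarith [mul_nonneg hla hlw]
      _ = _ := by ring
  · have hδ : 0 < w⁻¹ := inv_pos.2 hw
    have hgc : ContinuousOn g (Icc 0 a) := fun x hx => (hd x hx).continuousWithinAt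
    have hi : IntervalIntegrable
        (fun x : ℝ => g x * (Real.log x : ℂ) * Complex.exp (Complex.I * w * x)) volume 0 a := by
      have hlog : IntervalIntegrable (fun x : ℝ => (Real.log x : ℂ)) volume 0 a :=
        have h := intervalIntegral.intervalIntegrable_log' (a := 0) (b := a)
        ⟨h.1.ofReal, h.2.ofReal⟩
      refine (hlog.continuousOn_mul (by rwa [uIcc_of_le ha.le])).mul_continuousOn ?_
      fun_prop
    have hm : w⁻¹ ∈ uIcc 0 a := by rw [uIcc_of_le ha.le]; exact ⟨hδ.le, haw⟩
    rw [← intervalIntegral.integral_add_adjacent_intervals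
      (hi.mono_set (uIcc_subset_uIcc_left hm)) (hi.mono_set (uIcc_subset_uIcc_right hm))]
    refine (norm_add_le _ _).trans ((add_le_add (norm_integral_mul_log_mul_cexp_le hδ hK
      (fun x hx => hg x ⟨hx.1.le, hx.2.trans haw⟩) w)
      (norm_integral_mul_log_mul_cexp_le_of_inv_lt hK hw haw hd hd' hc'' hg hg' hg'' hga)).trans ?_)
    rw [Real.log_inv, abs_neg, inv_pow]
    calc K * (|Real.log w| + 1) * (w ^ 2)⁻¹
          + K * (6 * |Real.log w| + 6 * |Real.log a| + 1) * (w ^ 2)⁻¹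
        = K * (7 * |Real.log w| + 6 * |Real.log a| + 2) * (w ^ 2)⁻¹ := by ring
      _ ≤ K * (7 * (1 + |Real.log a|) * (1 + |Real.log w|)) * (w ^ 2)⁻¹ := by
          gcongr
          nlinarith [mul_nonneg hla hlw]
      _ = _ := by ring

theorem le_iSup_mem_of_continuousOn {s : Set ℝ} (hs : IsCompact s) {φ : ℝ → ℝ}
    (hφ : ContinuousOn φ s) (h0 : ∀ x ∈ s, 0 ≤ φ x) {x : ℝ} (hx : x ∈ s) :
    φ x ≤ ⨆ y ∈ s, φ y := by
  obtain ⟨B, hB⟩ := hs.bddAbove_image hφ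
  have hB' : ∀ y ∈ s, φ y ≤ B := fun y hy => hB (mem_image_of_mem φ hy)
  have hbdd : BddAbove (range fun y => ⨆ _ : y ∈ s, φ y) := by
    refine ⟨B, ?_⟩
    rintro _ ⟨y, rfl⟩
    exact Real.iSup_le (fun hy => hB' y hy) ((h0 x hx).trans (hB' x hx))
  refine le_trans (le_of_eq ?_) (le_ciSup hbdd x)
  simp [hx]

/-- Theorem 2, second bound (both endpoints included): there is `C = C(a) > 0` such that
for every `n ≥ 3`, `f ∈ Cⁿ([0,a],ℂ)`, distinct nodes `0 = x̂₀ < … < x̂_{n-1} = a`,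
Lagrange interpolant `f̂` of `f`, and `w > 0`:
`E_n(f) ≤ C (1+|log w|) w⁻² ‖f⁽ⁿ⁾‖_∞ a^{n-1}/(n-2)!`. -/
theorem stmt_12 (a : ℝ) (ha : 0 < a) :
    ∃ C > 0, ∀ n : ℕ, ∀ hn : 3 ≤ n,
      ∀ f : ℝ → ℂ, ContDiffOn ℝ n f (Icc 0 a) →
      ∀ xh : Fin n → ℝ, StrictMono xh → (∀ j, xh j ∈ Icc 0 a) →
        xh ⟨0, by omega⟩ = 0 → xh ⟨n - 1, by omega⟩ = a →
      ∀ fhat : Polynomial ℂ, fhat.degree < (n : ℕ) →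
        (∀ j : Fin n, fhat.eval ((xh j : ℝ) : ℂ) = f (xh j)) →
      ∀ w : ℝ, 0 < w →
      ‖∫ x in Ioc 0 a, (f x - fhat.eval ((x : ℝ) : ℂ)) * (Real.log x : ℂ)
          * Complex.exp (Complex.I * w * x)‖
        ≤ C * (1 + |Real.log w|) * (w ^ 2)⁻¹ *
            (⨆ x ∈ Icc 0 a, ‖iteratedDerivWithin n f (Icc 0 a) x‖) * a ^ (n - 1)
            / (Nat.factorial (n - 2)) := by
  refine ⟨7 * (1 + |Real.log a|), by positivity, ?_⟩
  intro n hn f hf xh hxh hmem hx0 hxa fhat hdeg hint w hw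
  set s : Set ℝ := Icc 0 a with hs
  have hud : UniqueDiffOn ℝ s := uniqueDiffOn_Icc ha
  set M : ℝ := ⨆ x ∈ s, ‖iteratedDerivWithin n f s x‖ with hMdef
  set D : ℕ → ℝ → ℂ := fun k x =>
    iteratedDerivWithin k f s x - (derivative^[k] fhat).eval (x : ℂ) with hDdef
  have hD : ∀ k < n, ∀ x ∈ s, HasDerivWithinAt (D k) (D (k + 1) x) s x := by
    intro k hk x hx
    have h1 := (hf.differentiableOn_iteratedDerivWithin (by exact_mod_cast hk) hud x
      hx).hasDerivWithinAt
    rw [← iteratedDerivWithin_succ] at h1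
    have h2 := ((derivative^[k] fhat).hasDerivAt (x : ℂ)).comp_ofReal.hasDerivWithinAt (s := s)
    rw [← Function.iterate_succ_apply' derivative] at h2
    exact h1.sub h2
  have hM : ∀ x ∈ s, ‖D n x‖ ≤ M := by
    intro x hx
    simp only [hDdef, iterate_derivative_eq_zero_of_degree_lt hdeg, eval_zero, sub_zero]
    exact le_iSup_mem_of_continuousOn (φ := fun x => ‖iteratedDerivWithin n f s x‖) isCompact_Icc
      (hf.continuousOn_iteratedDerivWithin le_rfl hud).norm (fun _ _ => norm_nonneg _) hx
  have hD0 : ∀ x, D 0 x = f x - fhat.eval (x : ℂ) := fun x => by simp [hDdef]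
  have hnode : ∀ j, D 0 (xh j) = 0 := fun j => by rw [hD0, hint j, sub_self]
  have hbound : ∀ j ≤ n, ∀ x ∈ s, ‖D j x‖ ≤ M * a ^ (n - j) / (n - j).factorial := by
    intro j hj x hx
    have := norm_le_of_card_zeros hD hM (S := Finset.univ.image xh)
      (by rw [Finset.card_image_of_injective _ hxh.injective]; simp)
      (fun x hx => by
        obtain ⟨j, -, rfl⟩ := Finset.mem_image.1 hx
        exact ⟨hmem j, hnode j⟩) hj hx
    simpa using this
  have h0s : (0 : ℝ) ∈ s := ⟨le_rfl, ha.le⟩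
  have hM0 : 0 ≤ M := (norm_nonneg _).trans (hM 0 h0s)
  set K : ℝ := M * a ^ (n - 1) / (n - 2).factorial with hKdef
  have hK : 0 ≤ K := by positivity
  have hD1 : ∀ x ∈ s, ‖D 1 x‖ ≤ K := by
    intro x hx
    refine (hbound 1 (by omega) x hx).trans ?_
    have : (n - 2).factorial ≤ (n - 1).factorial := Nat.factorial_le (by omega)
    rw [hKdef]
    gcongr
  have hD2 : ∀ x ∈ s, ‖D 2 x‖ ≤ K / a := by
    intro x hx
    refine (hbound 2 (by omega) x hx).trans (le_of_eq ?_)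
    rw [hKdef, show n - 1 = n - 2 + 1 by omega, pow_succ]
    field_simp
  have hDx : ∀ x ∈ s, ‖D 0 x‖ ≤ K * x := by
    intro x hx
    have h00 : D 0 0 = 0 := by simpa [hx0] using hnode ⟨0, by omega⟩
    have := (convex_Icc 0 a).norm_image_sub_le_of_norm_hasDerivWithin_le (hD 0 (by omega)) hD1
      h0s hx
    simpa [h00, abs_of_nonneg hx.1] using this
  have hmain := norm_integral_Ioc_mul_log_mul_cexp_le ha hK hw (hD 0 (by omega)) (hD 1 (by omega))
    (fun x hx => (hD 2 (by omega) x hx).continuousWithinAt) hDx hD1 hD2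
    (by simpa [hxa] using hnode ⟨n - 1, by omega⟩)
  simp only [hD0] at hmain
  refine hmain.trans (le_of_eq ?_)
  rw [hKdef]
  ring
end

section
/- Let a > 0. There exists a constant C > 0, depending only on a, such that for every real w > 0 and every ψ ∈ C^2([0,a], ℂ) satisfying ψ(0) = 0 and ψ(a) = 0: |∫_0^a ψ(x) · log(x) · e^{iwx} dx| ≤ C · (1 + |log w|) · w^{-2} · ( 2·‖ψ'‖_∞ + (5/2)·a·‖ψ''‖_∞ ). -/
open Set MeasureTheory

/-- Two integrations by parts against `e^{iwx}`. -/
lemma norm_integral_mul_exp_le {b c w : ℝ} (hbc : b ≤ c) (hw : 0 < w) {f f' f'' : ℝ → ℂ}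
    (hf : ∀ x ∈ Icc b c, HasDerivWithinAt f (f' x) (Icc b c) x)
    (hf' : ∀ x ∈ Icc b c, HasDerivWithinAt f' (f'' x) (Icc b c) x)
    (hf'' : ContinuousOn f'' (Icc b c)) :
    ‖∫ x in b..c, f x * Complex.exp (Complex.I * w * x)‖
      ≤ (‖f b‖ + ‖f c‖) / w + (‖f' b‖ + ‖f' c‖ + ∫ x in b..c, ‖f'' x‖) / w ^ 2 := by
  set e : ℝ → ℂ := fun x => Complex.exp (Complex.I * w * x) with he
  have hw0 : (w : ℂ) ≠ 0 := by exact_mod_cast hw.ne'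
  have hen (x : ℝ) : ‖e x‖ = 1 := by
    have : Complex.I * (w : ℂ) * x = ((w * x : ℝ) : ℂ) * Complex.I := by push_cast; ring
    simp only [he, this, Complex.norm_exp_ofReal_mul_I]
  have hkn : ‖Complex.I * (w : ℂ)‖ = w := by simp [abs_of_pos hw]
  have hed (x : ℝ) : HasDerivAt e (e x * (Complex.I * w)) x := by
    have h : HasDerivAt (fun x : ℝ => Complex.I * w * (x : ℂ)) (Complex.I * w) x := by
      simpa using (Complex.ofRealCLM.hasDerivAt (x := x)).const_mul (Complex.I * (w : ℂ))
    exact h.cexp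
  have hec : Continuous e := by fun_prop
  set F : ℝ → ℂ := fun x =>
    e x * (f x / (Complex.I * w) - f' x / (Complex.I * w) ^ 2) with hF
  have hFd : ∀ x ∈ Icc b c, HasDerivWithinAt F
      (f x * e x - e x * f'' x / (Complex.I * w) ^ 2) (Icc b c) x := by
    intro x hx
    refine ((hed x).hasDerivWithinAt.mul
      (((hf x hx).div_const (Complex.I * w)).sub
        ((hf' x hx).div_const ((Complex.I * w) ^ 2)))).congr_deriv ?_
    simp only [Pi.sub_apply]
    field_simp
    ring
  have hfc : ContinuousOn f (Icc b c) := fun x hx => (hf x hx).continuousWithinAt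
  have hi1 : IntervalIntegrable (fun x => f x * e x) volume b c :=
    (hfc.mul hec.continuousOn).intervalIntegrable_of_Icc hbc
  have hi2 : IntervalIntegrable (fun x => e x * f'' x / (Complex.I * w) ^ 2) volume b c :=
    ((hec.continuousOn.mul hf'').div_const _).intervalIntegrable_of_Icc hbc
  have hFTC := intervalIntegral.integral_eq_sub_of_hasDerivAt_of_le hbc
    (fun x hx => (hFd x hx).continuousWithinAt)
    (fun x hx => (hFd x (Ioo_subset_Icc_self hx)).hasDerivAt (Icc_mem_nhds hx.1 hx.2))
    (hi1.sub hi2)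
  rw [intervalIntegral.integral_sub hi1 hi2] at hFTC
  have hFn (x : ℝ) : ‖F x‖ ≤ ‖f x‖ / w + ‖f' x‖ / w ^ 2 := by
    rw [hF]
    simp only [norm_mul, hen, one_mul]
    refine (norm_sub_le _ _).trans_eq ?_
    rw [norm_div, norm_div, norm_pow, hkn]
  have hR : ‖∫ x in b..c, e x * f'' x / (Complex.I * w) ^ 2‖ ≤ (∫ x in b..c, ‖f'' x‖) / w ^ 2 := by
    rw [← intervalIntegral.integral_div]
    refine (intervalIntegral.norm_integral_le_integral_norm hbc).trans_eq ?_
    congr 1 with x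
    rw [norm_div, norm_mul, hen, norm_pow, hkn, one_mul]
  rw [sub_eq_iff_eq_add] at hFTC
  rw [hFTC]
  calc _ ≤ ‖F c‖ + ‖F b‖ + ‖∫ x in b..c, e x * f'' x / (Complex.I * w) ^ 2‖ :=
        (norm_add_le _ _).trans (by gcongr; exact norm_sub_le _ _)
    _ ≤ (‖f c‖ / w + ‖f' c‖ / w ^ 2) + (‖f b‖ / w + ‖f' b‖ / w ^ 2)
        + (∫ x in b..c, ‖f'' x‖) / w ^ 2 := by gcongr <;> apply hFn
    _ = _ := by ring

lemma mul_abs_log_le {x r : ℝ} (hx : 0 < x) (hxr : x ≤ r) :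
    x * |Real.log x| ≤ r * (|Real.log r| + 1) := by
  have hr : 0 < r := hx.trans_le hxr
  have h1 : Real.log (r / x) ≤ r / x :=
    (Real.log_le_sub_one_of_pos (by positivity)).trans (by linarith)
  rw [Real.log_div hr.ne' hx.ne'] at h1
  have h2 : Real.log x ≤ Real.log r := Real.log_le_log hx hxr
  have h3 : |Real.log x| ≤ |Real.log r| + r / x :=
    abs_le.2 ⟨by linarith [neg_abs_le (Real.log r)],
      by linarith [le_abs_self (Real.log r), div_pos hr hx]⟩
  calc x * |Real.log x| ≤ x * (|Real.log r| + r / x) := by gcongr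
    _ = x * |Real.log r| + r := by field_simp
    _ ≤ _ := by nlinarith [abs_nonneg (Real.log r)]

lemma log_one_add_le_one_add_abs_log {w : ℝ} (hw : 0 < w) :
    Real.log (1 + w) ≤ 1 + |Real.log w| := by
  have h2 := Real.log_two_lt_d9
  rcases le_total w 1 with h | h
  · have := Real.log_le_log (by linarith) (show 1 + w ≤ 2 by linarith)
    linarith [abs_nonneg (Real.log w)]
  · have := Real.log_le_log (by linarith) (show 1 + w ≤ 2 * w by linarith)
    rw [Real.log_mul two_ne_zero hw.ne'] at this
    linarith [le_abs_self (Real.log w)]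

lemma norm_le_biSup_of_continuousOn {g : ℝ → ℂ} {s : Set ℝ} (hs : IsCompact s)
    (hg : ContinuousOn g s) {x : ℝ} (hx : x ∈ s) : ‖g x‖ ≤ ⨆ y ∈ s, ‖g y‖ := by
  obtain ⟨B, hB⟩ := hs.exists_bound_of_continuousOn hg
  have hB0 : 0 ≤ B := (norm_nonneg _).trans (hB x hx)
  refine (ciSup_pos (f := fun _ : x ∈ s => ‖g x‖) hx).symm.le.trans
    (le_ciSup (f := fun y => ⨆ _ : y ∈ s, ‖g y‖) ⟨B, ?_⟩ x)
  rintro _ ⟨y, rfl⟩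
  exact Real.iSup_le (hB y) hB0

/-- The oscillatory integral estimate, with explicit bounds on the derivatives. -/
lemma norm_integral_mul_log_mul_exp_le {a w M₁ M₂ : ℝ} (ha : 0 < a) (hw : 0 < w)
    {ψ ψ' ψ'' : ℝ → ℂ}
    (hψ : ∀ x ∈ Icc 0 a, HasDerivWithinAt ψ (ψ' x) (Icc 0 a) x)
    (hψ' : ∀ x ∈ Icc 0 a, HasDerivWithinAt ψ' (ψ'' x) (Icc 0 a) x)
    (hψ'' : ContinuousOn ψ'' (Icc 0 a)) (h0 : ψ 0 = 0) (hψa : ψ a = 0)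
    (hM₁ : ∀ x ∈ Icc 0 a, ‖ψ' x‖ ≤ M₁) (hM₂ : ∀ x ∈ Icc 0 a, ‖ψ'' x‖ ≤ M₂) :
    ‖∫ x in Ioc 0 a, ψ x * (Real.log x : ℂ) * Complex.exp (Complex.I * w * x)‖
      ≤ ((2 * a ^ 2 + a + 8) * (1 + |Real.log a|)) * (1 + |Real.log w|) * (w ^ 2)⁻¹ *
          (2 * M₁ + (5 / 2) * a * M₂) := by
  set L := 1 + |Real.log w| with hL
  set A := 1 + |Real.log a| with hA
  have hL1 : 1 ≤ L := by simp [hL]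
  have hA1 : 1 ≤ A := by simp [hA]
  have hAL : A ≤ A * L := le_mul_of_one_le_right (by linarith) hL1
  have hLA : L ≤ A * L := le_mul_of_one_le_left (by linarith) hA1
  have hM₁0 : 0 ≤ M₁ := (norm_nonneg _).trans (hM₁ 0 ⟨le_rfl, ha.le⟩)
  have hM₂0 : 0 ≤ M₂ := (norm_nonneg _).trans (hM₂ 0 ⟨le_rfl, ha.le⟩)
  set r := a / (1 + w) with hr
  have hr0 : 0 < r := by positivity
  have hra : r ≤ a := div_le_self ha.le (by linarith)
  have hrw : r ≤ a / w := by rw [hr]; gcongr; linarith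
  have hlogw := log_one_add_le_one_add_abs_log hw
  have hlogw0 : 0 ≤ Real.log (1 + w) := Real.log_nonneg (by linarith)
  have hlogr : Real.log r = Real.log a - Real.log (1 + w) :=
    Real.log_div ha.ne' (by linarith)
  have hr_abs : |Real.log r| ≤ A * L := by
    have : |Real.log r| ≤ |Real.log a| + L := by
      rw [hlogr]
      exact abs_le.2 ⟨by linarith [neg_abs_le (Real.log a)],
        by linarith [le_abs_self (Real.log a)]⟩
    nlinarith [abs_nonneg (Real.log a)]
  have hlogx : ∀ x ∈ Icc r a, |Real.log x| ≤ A * L := by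
    intro x hx
    have h1 := Real.log_le_log hr0 hx.1
    have h2 := Real.log_le_log (hr0.trans_le hx.1) hx.2
    exact abs_le.2 ⟨by linarith [(abs_le.1 hr_abs).1],
      by linarith [le_abs_self (Real.log a)]⟩
  have hψn : ∀ x ∈ Icc 0 a, ‖ψ x‖ ≤ M₁ * x := by
    intro x hx
    have := (convex_Icc 0 a).norm_image_sub_le_of_norm_hasDerivWithin_le hψ hM₁
      ⟨le_rfl, ha.le⟩ hx
    simpa [h0, abs_of_nonneg hx.1] using this
  have hψc : ContinuousOn ψ (Icc 0 a) := fun x hx => (hψ x hx).continuousWithinAt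
  have hψ'c : ContinuousOn ψ' (Icc 0 a) := fun x hx => (hψ' x hx).continuousWithinAt
  have hsub : Icc r a ⊆ Icc 0 a := Icc_subset_Icc_left hr0.le
  have hint : IntervalIntegrable
      (fun x : ℝ => ψ x * (Real.log x : ℂ) * Complex.exp (Complex.I * w * x)) volume 0 a := by
    have hlog : IntervalIntegrable (fun x => (Real.log x : ℂ)) volume 0 a :=
      ⟨intervalIntegral.intervalIntegrable_log'.1.ofReal,
        intervalIntegral.intervalIntegrable_log'.2.ofReal⟩
    refine (hlog.continuousOn_mul (by rwa [uIcc_of_le ha.le])).mul_continuousOn ?_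
    fun_prop
  have hmem : r ∈ uIcc 0 a := by rw [uIcc_of_le ha.le]; exact ⟨hr0.le, hra⟩
  have hint1 := hint.mono_set (uIcc_subset_uIcc_left hmem)
  have hint2 := hint.mono_set (uIcc_subset_uIcc_right hmem)
  rw [← intervalIntegral.integral_of_le ha.le,
    ← intervalIntegral.integral_add_adjacent_intervals hint1 hint2]
  have hnear : ‖∫ x in (0 : ℝ)..r,
      ψ x * (Real.log x : ℂ) * Complex.exp (Complex.I * w * x)‖
        ≤ M₁ * (2 * a ^ 2 * (A * L)) / w ^ 2 := by
    have h1 : ∀ x ∈ uIoc 0 r,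
        ‖ψ x * (Real.log x : ℂ) * Complex.exp (Complex.I * w * x)‖
          ≤ M₁ * (r * (|Real.log r| + 1)) := by
      intro x hx
      rw [uIoc_of_le hr0.le] at hx
      have hexp : ‖Complex.exp (Complex.I * w * x)‖ = 1 := by
        rw [show Complex.I * (w : ℂ) * x = ((w * x : ℝ) : ℂ) * Complex.I by push_cast; ring,
          Complex.norm_exp_ofReal_mul_I]
      rw [norm_mul, norm_mul, hexp, mul_one, Complex.norm_real, Real.norm_eq_abs]
      calc ‖ψ x‖ * |Real.log x| ≤ M₁ * x * |Real.log x| := by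
            gcongr; exact hψn x ⟨hx.1.le, hx.2.trans hra⟩
        _ = M₁ * (x * |Real.log x|) := by ring
        _ ≤ _ := by exact mul_le_mul_of_nonneg_left (mul_abs_log_le hx.1 hx.2) hM₁0
    have h2 := intervalIntegral.norm_integral_le_of_norm_le_const h1
    rw [sub_zero, abs_of_pos hr0] at h2
    calc _ ≤ _ := h2
      _ ≤ M₁ * (a / w * (A * L + A * L)) * (a / w) := by gcongr; linarith
      _ = _ := by ring
  have hlogd : ∀ x ∈ Icc r a,
      HasDerivWithinAt (fun x : ℝ => (Real.log x : ℂ)) ((x : ℂ)⁻¹) (Icc r a) x := by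
    intro x hx
    simpa using (Real.hasDerivAt_log (hr0.trans_le hx.1).ne').ofReal_comp.hasDerivWithinAt
  have hinvd : ∀ x ∈ Icc r a,
      HasDerivWithinAt (fun x : ℝ => (x : ℂ)⁻¹) (-((x : ℂ) ^ 2)⁻¹) (Icc r a) x := by
    intro x hx
    simpa using (hasDerivAt_inv (hr0.trans_le hx.1).ne').ofReal_comp.hasDerivWithinAt
  have hf''c : ContinuousOn (fun x : ℝ => (ψ'' x * (Real.log x : ℂ) + ψ' x * (x : ℂ)⁻¹)
      + (ψ' x * (x : ℂ)⁻¹ + ψ x * -((x : ℂ) ^ 2)⁻¹)) (Icc r a) := by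
    have h1 : ContinuousOn (fun x : ℝ => (Real.log x : ℂ)) (Icc r a) :=
      fun x hx => (hlogd x hx).continuousWithinAt
    have h2 : ContinuousOn (fun x : ℝ => (x : ℂ)⁻¹) (Icc r a) :=
      fun x hx => (hinvd x hx).continuousWithinAt
    have h3 : ContinuousOn (fun x : ℝ => ((x : ℂ) ^ 2)⁻¹) (Icc r a) :=
      (h2.pow 2).congr fun x _ => by simp
    exact (((hψ''.mono hsub).mul h1).add ((hψ'c.mono hsub).mul h2)).add
      (((hψ'c.mono hsub).mul h2).add ((hψc.mono hsub).mul h3.neg))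
  have hfar := norm_integral_mul_exp_le hra hw
    (f := fun x => ψ x * (Real.log x : ℂ))
    (f' := fun x => ψ' x * (Real.log x : ℂ) + ψ x * (x : ℂ)⁻¹)
    (f'' := fun x => (ψ'' x * (Real.log x : ℂ) + ψ' x * (x : ℂ)⁻¹)
      + (ψ' x * (x : ℂ)⁻¹ + ψ x * -((x : ℂ) ^ 2)⁻¹))
    (fun x hx => ((hψ x (hsub hx)).mono hsub).mul (hlogd x hx))
    (fun x hx => (((hψ' x (hsub hx)).mono hsub).mul (hlogd x hx)).add
      (((hψ x (hsub hx)).mono hsub).mul (hinvd x hx)))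
    hf''c
  have hquot : ∀ x ∈ Icc r a, ‖ψ x‖ * x⁻¹ ≤ M₁ := by
    intro x hx
    have hx0 := hr0.trans_le hx.1
    rw [← div_eq_mul_inv, div_le_iff₀ hx0]
    exact hψn x (hsub hx)
  have hf'n : ∀ x ∈ Icc r a,
      ‖ψ' x * (Real.log x : ℂ) + ψ x * (x : ℂ)⁻¹‖ ≤ M₁ * (2 * (A * L)) := by
    intro x hx
    have hx0 := hr0.trans_le hx.1
    refine (norm_add_le _ _).trans ?_
    rw [norm_mul, norm_mul, norm_inv, Complex.norm_real, Complex.norm_real, Real.norm_eq_abs,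
      Real.norm_eq_abs, abs_of_pos hx0]
    calc _ ≤ M₁ * (A * L) + M₁ :=
          add_le_add (mul_le_mul (hM₁ x (hsub hx)) (hlogx x hx) (abs_nonneg _) hM₁0) (hquot x hx)
      _ ≤ _ := by nlinarith
  have hfr : ‖ψ r * (Real.log r : ℂ)‖ ≤ M₁ * (a * (A * L)) / w := by
    rw [norm_mul, Complex.norm_real, Real.norm_eq_abs]
    calc _ ≤ M₁ * (a / w) * (A * L) := by
          gcongr
          exact (hψn r ⟨hr0.le, hra⟩).trans (by gcongr)
      _ = _ := by ring
  have hf''n : ∫ x in r..a, ‖(ψ'' x * (Real.log x : ℂ) + ψ' x * (x : ℂ)⁻¹)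
      + (ψ' x * (x : ℂ)⁻¹ + ψ x * -((x : ℂ) ^ 2)⁻¹)‖ ≤ a * M₂ * (A * L) + 3 * M₁ * (A * L) := by
    have hi : IntervalIntegrable (fun x : ℝ => 3 * M₁ * x⁻¹) volume r a := by
      refine ContinuousOn.intervalIntegrable_of_Icc hra ?_
      exact continuousOn_const.mul
        (continuousOn_id.inv₀ fun x hx => (hr0.trans_le hx.1).ne')
    have hle : ∫ x in r..a, ‖(ψ'' x * (Real.log x : ℂ) + ψ' x * (x : ℂ)⁻¹)
        + (ψ' x * (x : ℂ)⁻¹ + ψ x * -((x : ℂ) ^ 2)⁻¹)‖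
          ≤ ∫ x in r..a, (M₂ * (A * L) + 3 * M₁ * x⁻¹) := by
      refine intervalIntegral.integral_mono_on hra (hf''c.norm.intervalIntegrable_of_Icc hra)
        (intervalIntegrable_const.add hi) fun x hx => ?_
      have hx0 := hr0.trans_le hx.1
      have hxi : 0 ≤ x⁻¹ := by positivity
      have hlog : ‖ψ'' x * (Real.log x : ℂ)‖ ≤ M₂ * (A * L) := by
        rw [norm_mul, Complex.norm_real, Real.norm_eq_abs]
        exact mul_le_mul (hM₂ x (hsub hx)) (hlogx x hx) (abs_nonneg _) hM₂0
      have hinv : ‖ψ' x * (x : ℂ)⁻¹‖ ≤ M₁ * x⁻¹ := by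
        rw [norm_mul, norm_inv, Complex.norm_real, Real.norm_eq_abs, abs_of_pos hx0]
        exact mul_le_mul_of_nonneg_right (hM₁ x (hsub hx)) hxi
      have hinv2 : ‖ψ x * -((x : ℂ) ^ 2)⁻¹‖ ≤ M₁ * x⁻¹ := by
        rw [norm_mul, norm_neg, norm_inv, norm_pow, Complex.norm_real, Real.norm_eq_abs,
          abs_of_pos hx0, sq, mul_inv, ← mul_assoc]
        exact mul_le_mul_of_nonneg_right (hquot x hx) hxi
      have h1 := norm_add_le (ψ'' x * (Real.log x : ℂ) + ψ' x * (x : ℂ)⁻¹)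
        (ψ' x * (x : ℂ)⁻¹ + ψ x * -((x : ℂ) ^ 2)⁻¹)
      have h2 := norm_add_le (ψ'' x * (Real.log x : ℂ)) (ψ' x * (x : ℂ)⁻¹)
      have h3 := norm_add_le (ψ' x * (x : ℂ)⁻¹) (ψ x * -((x : ℂ) ^ 2)⁻¹)
      linarith
    refine hle.trans ?_
    rw [intervalIntegral.integral_add intervalIntegrable_const hi,
      intervalIntegral.integral_const, intervalIntegral.integral_const_mul,
      integral_inv_of_pos hr0 ha, Real.log_div ha.ne' hr0.ne', hlogr, smul_eq_mul]
    have h1 : (a - r) * (M₂ * (A * L)) ≤ a * (M₂ * (A * L)) := by gcongr; linarith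
    have h2 : 3 * M₁ * Real.log (1 + w) ≤ 3 * M₁ * (A * L) := by gcongr; linarith
    linarith
  have hfa : ‖ψ a * (Real.log a : ℂ)‖ = 0 := by simp [hψa]
  calc _ ≤ M₁ * (2 * a ^ 2 * (A * L)) / w ^ 2 + ((M₁ * (a * (A * L)) / w + 0) / w
        + (M₁ * (2 * (A * L)) + M₁ * (2 * (A * L)) + (a * M₂ * (A * L) + 3 * M₁ * (A * L)))
          / w ^ 2) := by
        refine (norm_add_le _ _).trans (add_le_add hnear (hfar.trans ?_))
        rw [hfa]
        have := hf'n r ⟨le_rfl, hra⟩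
        have := hf'n a ⟨hra, le_rfl⟩
        gcongr
    _ = (w ^ 2)⁻¹ * (A * L) * (M₁ * (2 * a ^ 2 + a + 7) + a * M₂) := by field_simp; ring
    _ ≤ (w ^ 2)⁻¹ * (A * L) * ((2 * a ^ 2 + a + 8) * (2 * M₁ + (5 / 2) * a * M₂)) := by
        gcongr
        have : 0 ≤ a * M₂ := by positivity
        have : 0 ≤ (2 * a ^ 2 + a) * (a * M₂) := by positivity
        have : 0 ≤ (2 * a ^ 2 + a) * M₁ := by positivity
        linarith
    _ = _ := by ring

/-- The key estimate (3.15) in the proof of Theorem 2: there is `C = C(a) > 0` such that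
for every `w > 0` and `ψ ∈ C²([0,a],ℂ)` with `ψ(0) = ψ(a) = 0`:
`|∫_0^a ψ log x e^{iwx} dx| ≤ C (1+|log w|) w⁻² (2‖ψ'‖_∞ + (5/2) a ‖ψ''‖_∞)`. -/
theorem stmt_13 (a : ℝ) (ha : 0 < a) :
    ∃ C > 0, ∀ w : ℝ, 0 < w →
      ∀ ψ : ℝ → ℂ, ContDiffOn ℝ 2 ψ (Icc 0 a) → ψ 0 = 0 → ψ a = 0 →
      ‖∫ x in Ioc 0 a, ψ x * (Real.log x : ℂ) * Complex.exp (Complex.I * w * x)‖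
        ≤ C * (1 + |Real.log w|) * (w ^ 2)⁻¹ *
            (2 * (⨆ x ∈ Icc 0 a, ‖derivWithin ψ (Icc 0 a) x‖)
              + (5 / 2) * a * ⨆ x ∈ Icc 0 a, ‖iteratedDerivWithin 2 ψ (Icc 0 a) x‖) := by
  refine ⟨(2 * a ^ 2 + a + 8) * (1 + |Real.log a|), by positivity, ?_⟩
  intro w hw ψ hψ h0 hψa
  have hu : UniqueDiffOn ℝ (Icc 0 a) := uniqueDiffOn_Icc ha
  have hd : ContDiffOn ℝ 1 (derivWithin ψ (Icc 0 a)) (Icc 0 a) :=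
    hψ.derivWithin hu (by norm_num)
  have hs : ContinuousOn (iteratedDerivWithin 2 ψ (Icc 0 a)) (Icc 0 a) :=
    hψ.continuousOn_iteratedDerivWithin (by norm_num) hu
  refine norm_integral_mul_log_mul_exp_le ha hw (ψ' := derivWithin ψ (Icc 0 a))
    (ψ'' := iteratedDerivWithin 2 ψ (Icc 0 a)) ?_ ?_ hs h0 hψa
    (fun x hx => norm_le_biSup_of_continuousOn isCompact_Icc hd.continuousOn hx)
    (fun x hx => norm_le_biSup_of_continuousOn isCompact_Icc hs hx)
  · exact fun x hx => (hψ.differentiableOn (by norm_num) x hx).hasDerivWithinAt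
  · intro x hx
    rw [iteratedDerivWithin_succ, iteratedDerivWithin_one]
    exact (hd.differentiableOn (by norm_num) x hx).hasDerivWithinAt
end
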